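/- Let A be the 6×6 real matrix with rows (0,1,0,0,0,0), (1.000002542612694, 0, 0, 2, 0, 0), (0,0,0,1,0,0), (0, -0.000294117647059, 0, 0, 0, 0), (0,0,0,0,0,1), (0,0,0,0,-0.00000127311747,0), and let B be the 6×3 matrix whose columns are (0,1,0,0,0,0)ᵀ, (0,0,0,1,0,0)ᵀ and (0,0,0,0,0,1)ᵀ (thrusters in all three directions r, θ and z). Then the linear control system ẋ(t) = A x(t) + B u(t) is exactly controllable: for every t₀ < t₁ in ℝ and every pair of states x₀, x₁ ∈ ℝ⁶ there exist a continuous control u : ℝ → ℝ³ and a differentiable trajectory x : ℝ → ℝ⁶ satisfying x′(t) = A x(t) + B u(t) for all t, x(t₀) = x₀ and x(t₁) = x₁. -/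

import Mathlib

/-- Linearized satellite dynamics matrix under the `J₂` zonal harmonic. -/
def A : Matrix (Fin 6) (Fin 6) ℝ :=
  !![0, 1, 0, 0, 0, 0;
     1.000002542612694, 0, 0, 2, 0, 0;
     0, 0, 0, 1, 0, 0;
     0, -0.000294117647059, 0, 0, 0, 0;
     0, 0, 0, 0, 0, 1;
     0, 0, 0, 0, -0.00000127311747, 0]

/-- Input matrix: thruster columns. -/
def B : Matrix (Fin 6) (Fin 3) ℝ :=
  !![0, 0, 0;
     1, 0, 0;
     0, 0, 0;
     0, 1, 0;
     0, 0, 0;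
     0, 0, 1]

/-- Cubic Hermite interpolation: a point with prescribed positions and velocities at two times. -/
theorem exists_hermite_interpolant {t₀ t₁ : ℝ} (ht : t₀ < t₁) (p₀ v₀ p₁ v₁ : ℝ) :
    ∃ p v a : ℝ → ℝ, (∀ t, HasDerivAt p (v t) t) ∧ (∀ t, HasDerivAt v (a t) t) ∧ Continuous a ∧
      p t₀ = p₀ ∧ v t₀ = v₀ ∧ p t₁ = p₁ ∧ v t₁ = v₁ := by
  have h : t₁ - t₀ ≠ 0 := sub_ne_zero.mpr ht.ne'
  obtain ⟨c, d, hp, hv⟩ : ∃ c d : ℝ,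
      p₀ + v₀ * (t₁ - t₀) + c * (t₁ - t₀) ^ 2 + d * (t₁ - t₀) ^ 3 = p₁ ∧
      v₀ + 2 * c * (t₁ - t₀) + 3 * d * (t₁ - t₀) ^ 2 = v₁ := by
    refine ⟨(3 * (p₁ - p₀ - v₀ * (t₁ - t₀)) - (v₁ - v₀) * (t₁ - t₀)) / (t₁ - t₀) ^ 2,
      ((v₁ - v₀) * (t₁ - t₀) - 2 * (p₁ - p₀ - v₀ * (t₁ - t₀))) / (t₁ - t₀) ^ 3, ?_, ?_⟩ <;>
    · field_simp
      ring
  refine ⟨fun t => p₀ + v₀ * (t - t₀) + c * (t - t₀) ^ 2 + d * (t - t₀) ^ 3,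
    fun t => v₀ + 2 * c * (t - t₀) + 3 * d * (t - t₀) ^ 2,
    fun t => 2 * c + 6 * d * (t - t₀), fun t => ?_, fun t => ?_, by fun_prop,
    by simp, by simp, hp, hv⟩
  · have hs : HasDerivAt (fun t => t - t₀) 1 t := (hasDerivAt_id t).sub_const t₀
    refine ((((hs.const_mul v₀).const_add p₀).add ((hs.pow 2).const_mul c)).add
      ((hs.pow 3).const_mul d)).congr_deriv ?_
    push_cast
    ring
  · have hs : HasDerivAt (fun t => t - t₀) 1 t := (hasDerivAt_id t).sub_const t₀
    refine (((hs.const_mul (2 * c)).const_add v₀).add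
      ((hs.pow 2).const_mul (3 * d))).congr_deriv ?_
    push_cast
    ring

theorem controllable_rthetaz :
    ∀ t₀ t₁ : ℝ, t₀ < t₁ → ∀ x₀ x₁ : Fin 6 → ℝ,
      ∃ u : ℝ → Fin 3 → ℝ, Continuous u ∧
        ∃ x : ℝ → Fin 6 → ℝ,
          (∀ t : ℝ, HasDerivAt x (A.mulVec (x t) + B.mulVec (u t)) t) ∧
          x t₀ = x₀ ∧ x t₁ = x₁ := by
  intro t₀ t₁ ht x₀ x₁
  obtain ⟨r, rd, rdd, hr, hrd, hrdd, hr₀, hrd₀, hr₁, hrd₁⟩ :=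
    exists_hermite_interpolant ht (x₀ 0) (x₀ 1) (x₁ 0) (x₁ 1)
  obtain ⟨θ, θd, θdd, hθ, hθd, hθdd, hθ₀, hθd₀, hθ₁, hθd₁⟩ :=
    exists_hermite_interpolant ht (x₀ 2) (x₀ 3) (x₁ 2) (x₁ 3)
  obtain ⟨z, zd, zdd, hz, hzd, hzdd, hz₀, hzd₀, hz₁, hzd₁⟩ :=
    exists_hermite_interpolant ht (x₀ 4) (x₀ 5) (x₁ 4) (x₁ 5)
  have cr : Continuous r := continuous_iff_continuousAt.mpr fun t => (hr t).continuousAt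
  have crd : Continuous rd := continuous_iff_continuousAt.mpr fun t => (hrd t).continuousAt
  have cθd : Continuous θd := continuous_iff_continuousAt.mpr fun t => (hθd t).continuousAt
  have cz : Continuous z := continuous_iff_continuousAt.mpr fun t => (hz t).continuousAt
  refine ⟨fun t => ![rdd t - 1.000002542612694 * r t - 2 * θd t,
      θdd t + 0.000294117647059 * rd t, zdd t + 0.00000127311747 * z t], ?_,
    fun t => ![r t, rd t, θ t, θd t, z t, zd t], fun t => ?_, ?_, ?_⟩
  · refine continuous_pi fun i => ?_
    fin_cases i <;> simp <;> fun_prop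
  · have key : A.mulVec ![r t, rd t, θ t, θd t, z t, zd t] +
        B.mulVec ![rdd t - 1.000002542612694 * r t - 2 * θd t,
          θdd t + 0.000294117647059 * rd t, zdd t + 0.00000127311747 * z t] =
        ![rd t, rdd t, θd t, θdd t, zd t, zdd t] := by
      ext i
      fin_cases i <;> simp [A, B] <;> ring
    rw [key, hasDerivAt_pi]
    intro i
    fin_cases i
    exacts [hr t, hrd t, hθ t, hθd t, hz t, hzd t]
  · ext i
    fin_cases i
    exacts [hr₀, hrd₀, hθ₀, hθd₀, hz₀, hzd₀]
  · ext i
    fin_cases i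
    exacts [hr₁, hrd₁, hθ₁, hθd₁, hz₁, hzd₁]
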